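/- For every m ∈ ℤ, p(m) = ⌊m/2⌋; that is, the restriction of p to the integers is an extension to ℝ of the integer predecessor function m ↦ ⌊m/2⌋. -/

import Mathlib

noncomputable def parity (x : ℝ) : ℝ := max 0 (Real.pi / 2 * Real.sin (Real.pi * x))

noncomputable def pfun (x : ℝ) : ℝ := ∫ t in (0:ℝ)..(x - 1), parity t

theorem continuous_parity : Continuous parity := by
  unfold parity
  fun_prop

theorem periodic_parity : Function.Periodic parity 2 := fun x => by
  unfold parity
  rw [mul_add, mul_comm Real.pi 2, Real.sin_add_two_pi]

theorem integral_parity_neg_one_zero : ∫ t in (-1:ℝ)..0, parity t = 0 := by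
  refine intervalIntegral.integral_zero_ae (.of_forall fun t ht => max_eq_left ?_)
  rw [Set.uIoc_of_le (by norm_num)] at ht
  have hsin : Real.sin (Real.pi * t) ≤ 0 :=
    Real.sin_nonpos_of_nonpos_of_neg_pi_le (by nlinarith [Real.pi_pos, ht.2])
      (by nlinarith [Real.pi_pos, ht.1])
  exact mul_nonpos_of_nonneg_of_nonpos (by positivity) hsin

theorem integral_parity_zero_one : ∫ t in (0:ℝ)..1, parity t = 1 := by
  have h : Set.EqOn parity (fun t => Real.pi / 2 * Real.sin (Real.pi * t)) (Set.uIcc 0 1) := by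
    intro t ht
    rw [Set.uIcc_of_le zero_le_one] at ht
    have hsin : 0 ≤ Real.sin (Real.pi * t) :=
      Real.sin_nonneg_of_nonneg_of_le_pi (mul_nonneg Real.pi_pos.le ht.1)
        (mul_le_of_le_one_right Real.pi_pos.le ht.2)
    exact max_eq_right (by positivity)
  rw [intervalIntegral.integral_congr h, intervalIntegral.integral_const_mul,
    intervalIntegral.integral_comp_mul_left _ Real.pi_ne_zero, mul_zero, mul_one, integral_sin,
    Real.cos_zero, Real.cos_pi, smul_eq_mul]
  field_simp
  norm_num

theorem integral_parity_period (a : ℝ) : ∫ t in a..a + 2, parity t = 1 := by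
  rw [periodic_parity.intervalIntegral_add_eq a (-1),
    ← intervalIntegral.integral_add_adjacent_intervals
      (continuous_parity.intervalIntegrable (-1) 0) (continuous_parity.intervalIntegrable 0 _),
    integral_parity_neg_one_zero, show (-1 + 2 : ℝ) = 1 by norm_num, integral_parity_zero_one,
    zero_add]

theorem pfun_add_two_mul_int (x : ℝ) (k : ℤ) : pfun (x + 2 * k) = pfun x + k := by
  have h := periodic_parity.intervalIntegral_add_zsmul_eq k (x - 1)
    fun _ _ => continuous_parity.intervalIntegrable _ _
  rw [integral_parity_period, zsmul_one, zsmul_eq_mul] at h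
  unfold pfun
  rw [show x + 2 * k - 1 = x - 1 + k * 2 by ring,
    ← intervalIntegral.integral_add_adjacent_intervals
      (continuous_parity.intervalIntegrable 0 (x - 1)) (continuous_parity.intervalIntegrable _ _), h]

theorem pfun_zero : pfun 0 = 0 := by
  rw [pfun, zero_sub, intervalIntegral.integral_symm, integral_parity_neg_one_zero, neg_zero]

theorem pfun_one : pfun 1 = 0 := by
  rw [pfun, sub_self, intervalIntegral.integral_same]

theorem pfun_int (m : ℤ) : pfun (m : ℝ) = (⌊(m : ℝ) / 2⌋ : ℤ) := by
  obtain ⟨k, rfl | rfl⟩ := Int.even_or_odd' m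
  · have hfloor : ⌊((2 * k : ℤ) : ℝ) / 2⌋ = k := by
      rw [Int.floor_eq_iff]
      push_cast
      constructor <;> linarith
    have h := pfun_add_two_mul_int 0 k
    rw [hfloor]
    push_cast
    rwa [pfun_zero, zero_add, zero_add] at h
  · have hfloor : ⌊((2 * k + 1 : ℤ) : ℝ) / 2⌋ = k := by
      rw [Int.floor_eq_iff]
      push_cast
      constructor <;> linarith
    have h := pfun_add_two_mul_int 1 k
    rw [hfloor]
    push_cast
    rwa [pfun_one, zero_add, add_comm] at h
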